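/- Let (E_k)_{k≥1} be a sequence of events on a probability space such that ∑_{k=1}^∞ P(E_k) = ∞ and ∑_{i<j} |Cov(1_{E_i}, 1_{E_j})| < ∞. Then P( E_k occurs for infinitely many k ) = 1, i.e. P( limsup_k E_k ) = 1. -/

import Mathlib

open MeasureTheory Filter

lemma bc_aux
    {Ω : Type*} [MeasurableSpace Ω] (P : Measure Ω) [IsProbabilityMeasure P]
    (E : ℕ → Set Ω) (hE : ∀ k, MeasurableSet (E k))
    (hdiv : ¬ Summable (fun k => (P (E k)).toReal))
    (hcov : Summable (fun p : ℕ × ℕ =>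
      if p.1 < p.2 then
        |(P (E p.1 ∩ E p.2)).toReal - (P (E p.1)).toReal * (P (E p.2)).toReal|
      else 0)) :
    P (⋂ k, (E k)ᶜ) = 0 := by
  set f : ℕ × ℕ → ℝ := fun p : ℕ × ℕ =>
      if p.1 < p.2 then
        |(P (E p.1 ∩ E p.2)).toReal - (P (E p.1)).toReal * (P (E p.2)).toReal|
      else 0 with hf
  have hf0 : ∀ p, 0 ≤ f p := by
    intro p
    simp only [hf]
    split_ifs <;> positivity
  set C : ℝ := ∑' p, f p with hC
  have hC0 : 0 ≤ C := tsum_nonneg hf0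
  let X : ℕ → Ω → ℝ := fun k => (E k).indicator (fun _ => (1 : ℝ))
  have hX : ∀ k, MemLp (X k) 2 P := fun k =>
    memLp_indicator_const 2 (hE k) 1 (Or.inr (measure_ne_top _ _))
  have hXint : ∀ k, ∫ ω, X k ω ∂P = (P (E k)).toReal := by
    intro k
    simp only [X]
    rw [integral_indicator_const _ (hE k)]
    simp [Measure.real]
  have hcovX : ∀ i j, ProbabilityTheory.covariance (X i) (X j) P
      = (P (E i ∩ E j)).toReal - (P (E i)).toReal * (P (E j)).toReal := by
    intro i j
    rw [ProbabilityTheory.covariance_eq_sub (hX i) (hX j), hXint, hXint]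
    congr 1
    have : X i * X j = (E i ∩ E j).indicator (fun _ => (1 : ℝ)) := by
      ext ω
      by_cases h1 : ω ∈ E i <;> by_cases h2 : ω ∈ E j <;> simp [X, h1, h2]
    rw [this, integral_indicator_const _ ((hE i).inter (hE j))]
    simp [Measure.real]
  have hbound : ∀ i j, ProbabilityTheory.covariance (X i) (X j) P
      ≤ (if i = j then (P (E i)).toReal else 0) + f (i, j) + f (j, i) := by
    intro i j
    rw [hcovX]
    rcases lt_trichotomy i j with h | h | h
    · simp only [hf, h, h.ne, h.not_gt, if_true, if_false]
      linarith [le_abs_self ((P (E i ∩ E j)).toReal - (P (E i)).toReal * (P (E j)).toReal)]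
    · subst h
      simp only [hf, lt_irrefl, if_true, if_false, Set.inter_self]
      nlinarith [mul_self_nonneg (P (E i)).toReal]
    · simp only [hf, h, h.ne', h.not_gt, if_true, if_false]
      rw [Set.inter_comm (E i), mul_comm (P (E i)).toReal]
      linarith [le_abs_self ((P (E j ∩ E i)).toReal - (P (E j)).toReal * (P (E i)).toReal)]
  set M : ℕ → ℝ := fun n => ∑ k ∈ Finset.range n, (P (E k)).toReal with hM
  have hsum : ∀ n, ∑ i ∈ Finset.range n, ∑ j ∈ Finset.range n, f (i, j) ≤ C := by
    intro n
    rw [← Finset.sum_product']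
    exact hcov.sum_le_tsum _ (fun p _ => hf0 p)
  have hvar : ∀ n, ProbabilityTheory.variance (∑ k ∈ Finset.range n, X k) P ≤ M n + 2 * C := by
    intro n
    rw [ProbabilityTheory.variance_sum' (fun i _ => hX i)]
    calc _ ≤ ∑ i ∈ Finset.range n, ∑ j ∈ Finset.range n,
          ((if i = j then (P (E i)).toReal else 0) + f (i, j) + f (j, i)) :=
          Finset.sum_le_sum fun i _ => Finset.sum_le_sum fun j _ => hbound i j
      _ = M n + ∑ i ∈ Finset.range n, ∑ j ∈ Finset.range n, f (i, j)
          + ∑ i ∈ Finset.range n, ∑ j ∈ Finset.range n, f (j, i) := by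
          simp only [Finset.sum_add_distrib]
          congr 2
          refine Finset.sum_congr rfl fun i hi => ?_
          rw [Finset.sum_ite_eq, if_pos hi]
      _ ≤ _ := by
          have h1 := hsum n
          have h2 := hsum n
          rw [Finset.sum_comm] at h2
          linarith
  have htend : Tendsto M atTop atTop :=
    (not_summable_iff_tendsto_nat_atTop_of_nonneg (fun k => ENNReal.toReal_nonneg)).1 hdiv
  have hcheb : ∀ n, 0 < M n → (P (⋂ k, (E k)ᶜ)).toReal * M n ^ 2 ≤ M n + 2 * C := by
    intro n hn
    have hS : MemLp (∑ k ∈ Finset.range n, X k) 2 P := memLp_finset_sum' _ fun i _ => hX i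
    have h := ProbabilityTheory.meas_ge_le_variance_div_sq hS hn
    have hmean : ∫ ω, (∑ k ∈ Finset.range n, X k) ω ∂P = M n := by
      simp only [Finset.sum_apply]
      rw [integral_finset_sum _ (fun i _ => (hX i).integrable (by norm_num))]
      simp only [hXint, hM]
    rw [hmean] at h
    have hsub : (⋂ k, (E k)ᶜ) ⊆ {ω | M n ≤ |(∑ k ∈ Finset.range n, X k) ω - M n|} := by
      intro ω hω
      have h0 : (∑ k ∈ Finset.range n, X k) ω = 0 := by
        rw [Finset.sum_apply]
        refine Finset.sum_eq_zero fun k _ => ?_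
        have := Set.mem_iInter.1 hω k
        exact Set.indicator_of_notMem this _
      simp only [Set.mem_setOf_eq, h0, zero_sub, abs_neg]
      exact le_abs_self _
    have h' := ENNReal.toReal_mono ENNReal.ofReal_ne_top ((measure_mono hsub).trans h)
    rw [ENNReal.toReal_ofReal (div_nonneg (ProbabilityTheory.variance_nonneg _ _) (by positivity)),
      le_div_iff₀ (by positivity)] at h'
    exact h'.trans (hvar n)
  by_contra hne
  have ha : 0 < (P (⋂ k, (E k)ᶜ)).toReal := ENNReal.toReal_pos hne (measure_ne_top _ _)
  set a := (P (⋂ k, (E k)ᶜ)).toReal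
  obtain ⟨n, hn1, hn2⟩ := ((htend.eventually_ge_atTop 1).and
    (htend.eventually_gt_atTop ((1 + 2 * C) / a))).exists
  have h := hcheb n (by linarith)
  rw [div_lt_iff₀ ha] at hn2
  nlinarith

/-- **A second Borel–Cantelli lemma under summable covariances.**
If `∑_k P(E_k) = ∞` and `∑_{i<j} |Cov(1_{E_i}, 1_{E_j})| < ∞`, then
`P(limsup_k E_k) = 1`. -/
theorem borel_cantelli_summable_covariance
    {Ω : Type*} [MeasurableSpace Ω] (P : Measure Ω) [IsProbabilityMeasure P]
    (E : ℕ → Set Ω) (hE : ∀ k, MeasurableSet (E k))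
    (hdiv : (∑' k : ℕ, P (E k)) = ⊤)
    (hcov : Summable (fun p : ℕ × ℕ =>
      if p.1 < p.2 then
        |(P (E p.1 ∩ E p.2)).toReal - (P (E p.1)).toReal * (P (E p.2)).toReal|
      else 0)) :
    P (Filter.atTop.limsup E) = 1 := by
  have hns : ¬ Summable (fun k => (P (E k)).toReal) := by
    intro hs
    have h := ENNReal.ofReal_tsum_of_nonneg (fun k => ENNReal.toReal_nonneg) hs
    simp only [ENNReal.ofReal_toReal (measure_ne_top P _)] at h
    rw [hdiv] at h
    exact ENNReal.ofReal_ne_top h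
  have hz : ∀ m, P (⋂ k, (E (k + m))ᶜ) = 0 := by
    intro m
    refine bc_aux P (fun k => E (k + m)) (fun k => hE _) ?_ ?_
    · exact fun h => hns ((summable_nat_add_iff (f := fun k => (P (E k)).toReal) m).1 h)
    · have hinj : Function.Injective (fun p : ℕ × ℕ => (p.1 + m, p.2 + m)) := by
        rintro ⟨a, b⟩ ⟨c, d⟩ h
        simpa using h
      refine (hcov.comp_injective hinj).congr fun p => ?_
      simp
  rw [← prob_compl_eq_zero_iff (MeasurableSet.measurableSet_limsup hE)]
  refine measure_mono_null ?_ (measure_iUnion_null hz)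
  intro ω hω
  rw [Set.mem_compl_iff, mem_limsup_iff_frequently_mem, not_frequently,
    eventually_atTop] at hω
  obtain ⟨m, hm⟩ := hω
  exact Set.mem_iUnion.2 ⟨m, Set.mem_iInter.2 fun k => hm _ (Nat.le_add_left _ _)⟩
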